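/- If the real A⊕B is Martin-Löf BP random, then A is Martin-Löf BP random relative to B and B is Martin-Löf BP random relative to A. -/

import Mathlib

namespace BP



/-- The finite binary string `(X 0, …, X (n−1))`. -/
def take (X : ℕ → Bool) (n : ℕ) : List Bool := (List.range n).map X

/-- `X ∈ [G]`: the real `X` extends some string of the finite set (list) `G`. -/
def Mem (X : ℕ → Bool) (G : List (List Bool)) : Prop :=
  ∃ τ ∈ G, take X τ.length = τ

/-- The maximum length of a string in `G`. -/
def maxLen (G : List (List Bool)) : ℕ := (G.map List.length).foldr max 0

/-- The list of all binary strings of length `L`. -/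
def allStrings (L : ℕ) : List (List Bool) :=
  (List.range (2 ^ L)).map fun k => (List.range L).map fun i => k.testBit i

/-- The uniform (fair-coin) measure of the clopen set `[G]`, computed by counting
which strings of length `maxLen G` extend a member of `G`. -/
def mu (G : List (List Bool)) : ℚ :=
  (((allStrings (maxLen G)).filter fun σ => G.any fun τ => decide (τ <+: σ)).length : ℚ)
    / 2 ^ maxLen G

/-- The uniform measure of `[G] ∩ [τ]`. -/
def muCap (G : List (List Bool)) (τ : List Bool) : ℚ :=
  (((allStrings (max (maxLen G) τ.length)).filter fun σ =>
      decide (τ <+: σ) && (G.any fun ρ => decide (ρ <+: σ))).length : ℚ)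
    / 2 ^ max (maxLen G) τ.length

/-- A primitive recursive test: a primitive recursive sequence of finite sets of
binary strings with `μ([Gₙ]) ≤ 2⁻ⁿ`. -/
def IsTest (G : ℕ → List (List Bool)) : Prop :=
  Primrec G ∧ ∀ n, mu (G n) ≤ ((2 : ℚ) ^ n)⁻¹

/-- `X` is Martin-Löf BP random. -/
def MLBPRandom (X : ℕ → Bool) : Prop :=
  ∀ G : ℕ → List (List Bool), IsTest G → ∃ n, ¬ Mem X (G n)

/-- A weak primitive recursive test. -/
def IsWeakTest (G : ℕ → List (List Bool)) : Prop :=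
  IsTest G ∧ ∃ ℓ : ℕ → ℕ, Primrec ℓ ∧ (∀ n, ∀ τ ∈ G n, τ.length = ℓ n) ∧
    ∀ n, ∀ τ ∈ G n, muCap (G (n + 1)) τ ≤ (1 / 2) * ((2 : ℚ) ^ τ.length)⁻¹

/-- A martingale with values in the nonnegative rationals. -/
def IsMartingale (d : List Bool → ℚ) : Prop :=
  d [] = 1 ∧ (∀ σ, 0 ≤ d σ) ∧
    ∀ σ, d σ = (d (σ ++ [false]) + d (σ ++ [true])) / 2

/-- The martingale `d` succeeds primitive recursively on `X`. -/
def SucceedsPR (d : List Bool → ℚ) (X : ℕ → Bool) : Prop :=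
  ∃ f : ℕ → ℕ, Primrec f ∧ ∀ n, (2 : ℚ) ^ n ≤ d (take X (f n))

/-- `X` is martingale BP random. -/
def MartingaleBPRandom (X : ℕ → Bool) : Prop :=
  ¬ ∃ d : List Bool → ℚ, Primrec d ∧ IsMartingale d ∧ SucceedsPR d X

/-- `X` is primitive recursively compressed by the machine `M`. -/
def CompressedBy (M : List Bool → List Bool) (X : ℕ → Bool) : Prop :=
  ∃ f : ℕ → ℕ, Primrec f ∧
    ∀ c, ∃ σ : List Bool, σ.length ≤ f c - c ∧ M σ = take X (f c)

/-- `X` is Kolmogorov BP random. -/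
def KolmogorovBPRandom (X : ℕ → Bool) : Prop :=
  ¬ ∃ M : List Bool → List Bool, Primrec M ∧ CompressedBy M X

/-- `M` is a (total) process machine: it is extension preserving. -/
def IsProcessMachine (M : List Bool → List Bool) : Prop :=
  ∀ σ τ : List Bool, σ <+: τ → M σ <+: M τ

/-- `M` is a quick process BP machine. -/
def IsQuickProcessBP (M : List Bool → List Bool) : Prop :=
  Primrec M ∧ IsProcessMachine M ∧
    ∃ h : ℕ → ℕ, Primrec h ∧ Monotone h ∧ (∀ k, ∃ n, k ≤ h n) ∧
      ∀ τ : List Bool, h τ.length ≤ (M τ).length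

/-- `X` is quick process BP random. -/
def QuickProcessBPRandom (X : ℕ → Bool) : Prop :=
  ¬ ∃ M : List Bool → List Bool, IsQuickProcessBP M ∧ CompressedBy M X

/-- The number of `i < n` with `X i = true`. -/
def cardBelow (X : ℕ → Bool) (n : ℕ) : ℕ := (List.range n).countP X





/-- Uniform oracle primitive recursion on ℕ: the inductive closure of the basic
primitive recursive functions together with (the characteristic function of) the
oracle, under pairing, composition and primitive recursion, uniformly in the
oracle `O : ℕ → Bool`. -/
inductive PrimrecIn : ((ℕ → Bool) → ℕ → ℕ) → Prop
  | zero : PrimrecIn fun _ _ => 0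
  | succ : PrimrecIn fun _ n => n + 1
  | left : PrimrecIn fun _ n => n.unpair.1
  | right : PrimrecIn fun _ n => n.unpair.2
  | oracle : PrimrecIn fun O n => cond (O n) 1 0
  | pair {f g} : PrimrecIn f → PrimrecIn g →
      PrimrecIn fun O n => Nat.pair (f O n) (g O n)
  | comp {f g} : PrimrecIn f → PrimrecIn g →
      PrimrecIn fun O n => f O (g O n)
  | prec {f g} : PrimrecIn f → PrimrecIn g →
      PrimrecIn fun O p =>
        p.unpair.2.rec (f O p.unpair.1) fun y IH => g O (Nat.pair p.unpair.1 (Nat.pair y IH))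

/-- A primitive recursive oracle function between `Primcodable` types:
it is given by a single uniform oracle primitive recursive derivation. -/
def OraclePrimrec {α β : Type} [Primcodable α] [Primcodable β]
    (f : (ℕ → Bool) → α → β) : Prop :=
  ∃ F : (ℕ → Bool) → ℕ → ℕ, PrimrecIn F ∧
    ∀ (O : ℕ → Bool) (n : ℕ),
      F O n = Encodable.encode ((Encodable.decode (α := α) n).map (f O))



/-- A primitive recursive oracle test: a primitive recursive oracle function
`Z ↦ (Gₙ^Z)` together with a primitive recursive length bound `f`, such that for
every oracle `Z`, `Gₙ^Z` consists of strings of length at most `f n` and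
`μ([Gₙ^Z]) ≤ 2⁻ⁿ`. -/
def IsOracleTest (G : (ℕ → Bool) → ℕ → List (List Bool)) (f : ℕ → ℕ) : Prop :=
  OraclePrimrec G ∧ Primrec f ∧
    (∀ (Z : ℕ → Bool) (n : ℕ), ∀ τ ∈ G Z n, τ.length ≤ f n) ∧
    ∀ (Z : ℕ → Bool) (n : ℕ), mu (G Z n) ≤ ((2 : ℚ) ^ n)⁻¹

/-- `X` is Martin-Löf BP random relative to the oracle `Y`. -/
def MLBPRandomRel (X Y : ℕ → Bool) : Prop :=
  ∀ (G : (ℕ → Bool) → ℕ → List (List Bool)) (f : ℕ → ℕ),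
    IsOracleTest G f → ∃ n, ¬ Mem X (G Y n)

/-- The join `A ⊕ B` of two reals: `(A⊕B)(2n) = A(n)` and `(A⊕B)(2n+1) = B(n)`. -/
def join (A B : ℕ → Bool) : ℕ → Bool := fun n => if n % 2 = 0 then A (n / 2) else B (n / 2)


/-- The real extending the finite string `x` by zeros. -/
def pad (x : List Bool) : ℕ → Bool := fun i => x.getD i false

/-- The bits of `σ` at the positions `b, 2 + b, …, 2 (L - 1) + b`. -/
def slice (b L : ℕ) (σ : List Bool) : List Bool := take (fun i => pad σ (2 * i + b)) L

/-- The finite set of strings of length `L`. -/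
def strings (L : ℕ) : Finset (List Bool) := (allStrings L).toFinset

theorem length_take (X : ℕ → Bool) (n : ℕ) : (take X n).length = n := by
  simp [take]

theorem take_congr {X Y : ℕ → Bool} {n : ℕ} (h : ∀ i < n, X i = Y i) : take X n = take Y n := by
  simpa [take] using h

theorem pad_take (X : ℕ → Bool) {n i : ℕ} (hi : i < n) : pad (take X n) i = X i := by
  simp [pad, take, List.getD_eq_getElem?_getD, hi]

theorem take_pad_eq (x : List Bool) : take (pad x) x.length = x := by
  apply List.ext_getElem
  · simp [take]
  · intro i h₁ h₂
    simp [take, pad, List.getD_eq_getElem?_getD, h₂]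

theorem take_prefix_take (X : ℕ → Bool) {m n : ℕ} (h : m ≤ n) : take X m <+: take X n := by
  obtain ⟨k, rfl⟩ := Nat.exists_eq_add_of_le h
  simp [take, List.range_add]

theorem length_of_mem_allStrings {L : ℕ} {x : List Bool} (h : x ∈ allStrings L) :
    x.length = L := by
  obtain ⟨k, -, rfl⟩ := List.mem_map.1 h
  simp

theorem mem_allStrings {L : ℕ} {x : List Bool} : x ∈ allStrings L ↔ x.length = L := by
  refine ⟨length_of_mem_allStrings, ?_⟩
  rintro rfl
  refine List.mem_map.2 ⟨Nat.ofBits fun i : Fin x.length => x[i], ?_, ?_⟩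
  · exact List.mem_range.2 (Nat.ofBits_lt_two_pow _)
  · apply List.ext_getElem
    · simp
    · intro i h₁ h₂
      simp [Nat.testBit_ofBits_lt, h₂]

theorem nodup_allStrings (L : ℕ) : (allStrings L).Nodup := by
  refine List.Nodup.map_on ?_ List.nodup_range
  intro a ha b hb hab
  rw [List.mem_range] at ha hb
  apply Nat.eq_of_testBit_eq
  intro i
  by_cases hi : i < L
  · have := List.map_inj_left.1 hab i (List.mem_range.2 hi)
    exact this
  · have hL : 2 ^ L ≤ 2 ^ i := Nat.pow_le_pow_right (by norm_num) (not_lt.1 hi)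
    rw [Nat.testBit_lt_two_pow (ha.trans_le hL), Nat.testBit_lt_two_pow (hb.trans_le hL)]

theorem mem_strings {L : ℕ} {x : List Bool} : x ∈ strings L ↔ x.length = L := by
  rw [strings, List.mem_toFinset, mem_allStrings]

theorem card_strings (L : ℕ) : (strings L).card = 2 ^ L := by
  rw [strings, List.toFinset_card_of_nodup (nodup_allStrings L)]
  simp [allStrings]

theorem length_le_maxLen {G : List (List Bool)} {τ : List Bool} (h : τ ∈ G) :
    τ.length ≤ maxLen G := by
  induction G with
  | nil => simp at h
  | cons a G ih =>
    rcases List.mem_cons.1 h with rfl | h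
    · exact le_max_left _ _
    · exact (ih h).trans (le_max_right _ _)

theorem maxLen_le {G : List (List Bool)} {L : ℕ} (h : ∀ τ ∈ G, τ.length ≤ L) : maxLen G ≤ L := by
  induction G with
  | nil => simp [maxLen]
  | cons a G ih =>
    exact max_le (h a (by simp)) (ih fun τ hτ => h τ (by simp [hτ]))

/-- If all strings in `H` have length `L`, then `μ [H]` is at most `|H| / 2 ^ L`. -/
theorem mu_le_card_div {H : List (List Bool)} {L : ℕ} (hH : ∀ τ ∈ H, τ.length = L) :
    mu H ≤ (H.toFinset.card : ℚ) / 2 ^ L := by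
  rcases H.eq_nil_or_concat with rfl | ⟨H', τ, hτ⟩
  · simp [mu]
  have hmax : maxLen H = L := by
    apply le_antisymm (maxLen_le fun τ hτ => (hH τ hτ).le)
    have hm : τ ∈ H := by simp [hτ]
    exact (hH τ hm).symm.le.trans (length_le_maxLen hm)
  rw [mu, hmax]
  gcongr
  rw [← List.toFinset_card_of_nodup ((nodup_allStrings L).filter _)]
  apply Finset.card_le_card
  intro σ hσ
  rw [List.mem_toFinset, List.mem_filter, List.any_eq_true] at hσ
  obtain ⟨hσ, ρ, hρ, h⟩ := hσ
  have := (of_decide_eq_true h).eq_of_length ((hH ρ hρ).trans (length_of_mem_allStrings hσ).symm)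
  rw [List.mem_toFinset]
  exact this ▸ hρ

/-- The number of strings of length `L` extending a string of `G` is at most `2 ^ L * μ [G]`. -/
theorem card_le_mu_mul {G : List (List Bool)} {L : ℕ} (hL : ∀ τ ∈ G, τ.length ≤ L) :
    (((strings L).filter fun x => ∃ τ ∈ G, τ <+: x).card : ℚ) ≤ mu G * 2 ^ L := by
  set M := maxLen G with hM
  obtain ⟨k, rfl⟩ := Nat.exists_eq_add_of_le (maxLen_le hL)
  set T := ((allStrings M).filter fun σ => G.any fun τ => decide (τ <+: σ)) with hT
  have key : ((strings (M + k)).filter fun x => ∃ τ ∈ G, τ <+: x).card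
      ≤ (T.toFinset ×ˢ strings k).card := by
    apply Finset.card_le_card_of_injOn fun x => (x.take M, x.drop M)
    · intro x hx
      simp only [Finset.coe_filter, Set.mem_ofPred_eq, mem_strings] at hx
      obtain ⟨hx, τ, hτ, h⟩ := hx
      simp only [Finset.coe_product, Set.mem_prod, Finset.mem_coe, List.mem_toFinset, hT,
        List.mem_filter, mem_allStrings, List.any_eq_true, mem_strings, List.length_take,
        List.length_drop, decide_eq_true_eq]
      exact ⟨⟨by omega, τ, hτ, List.prefix_take_iff.2 ⟨h, length_le_maxLen hτ⟩⟩, by omega⟩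
    · intro x _ y _ hxy
      simp only [Prod.mk.injEq] at hxy
      rw [← List.take_append_drop M x, hxy.1, hxy.2, List.take_append_drop]
  rw [Finset.card_product, card_strings,
    List.toFinset_card_of_nodup ((nodup_allStrings M).filter _)] at key
  have key' : (((strings (M + k)).filter fun x => ∃ τ ∈ G, τ <+: x).card : ℚ)
      ≤ T.length * 2 ^ k := by exact_mod_cast key
  refine key'.trans_eq ?_
  rw [mu, ← hM, ← hT, pow_add]
  field_simp

theorem length_slice (b L : ℕ) (σ : List Bool) : (slice b L σ).length = L := length_take _ _

theorem eq_of_slice_eq {b c L : ℕ} (hbc : b + c = 1) {σ ρ : List Bool} (hσ : σ.length = 2 * L)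
    (hρ : ρ.length = 2 * L) (hb : slice b L σ = slice b L ρ) (hc : slice c L σ = slice c L ρ) :
    σ = ρ := by
  rw [← take_pad_eq σ, ← take_pad_eq ρ, hσ, hρ]
  apply take_congr
  intro i hi
  have hb' := List.map_inj_left.1 hb (i / 2) (List.mem_range.2 (by omega))
  have hc' := List.map_inj_left.1 hc (i / 2) (List.mem_range.2 (by omega))
  by_cases h : i % 2 = b
  · rwa [show 2 * (i / 2) + b = i by omega] at hb'
  · rwa [show 2 * (i / 2) + c = i by omega] at hc'

/-- The strings of length `2 * L` whose `b`-slice extends an element of the set assigned to the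
`c`-slice. -/
def joinSet (b c L : ℕ) (G : List Bool → List (List Bool)) : List (List Bool) :=
  (allStrings (2 * L)).filter fun σ =>
    decide (∃ τ ∈ G (slice c L σ), take (pad (slice b L σ)) τ.length = τ)

theorem length_of_mem_joinSet {b c L : ℕ} {G : List Bool → List (List Bool)} {σ : List Bool}
    (h : σ ∈ joinSet b c L G) : σ.length = 2 * L :=
  length_of_mem_allStrings (List.mem_filter.1 h).1

/-- Fubini's inequality for `joinSet`. -/
theorem mu_joinSet_le {b c L : ℕ} (hbc : b + c = 1) {G : List Bool → List (List Bool)} {ε : ℚ}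
    (hL : ∀ z, ∀ τ ∈ G z, τ.length ≤ L) (hG : ∀ z, mu (G z) ≤ ε) :
    mu (joinSet b c L G) ≤ ε := by
  refine (mu_le_card_div fun τ => length_of_mem_joinSet).trans ?_
  rw [div_le_iff₀ (by positivity)]
  have hmaps : ∀ σ ∈ (joinSet b c L G).toFinset, slice c L σ ∈ strings L :=
    fun σ _ => mem_strings.2 (length_slice _ _ _)
  rw [Finset.card_eq_sum_card_fiberwise hmaps, Nat.cast_sum]
  have hfib : ∀ z ∈ strings L,
      (((joinSet b c L G).toFinset.filter fun σ => slice c L σ = z).card : ℚ) ≤ ε * 2 ^ L := by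
    intro z _
    refine le_trans ?_ ((card_le_mu_mul (hL z)).trans
      (mul_le_mul_of_nonneg_right (hG z) (by positivity)))
    rw [Nat.cast_le]
    apply Finset.card_le_card_of_injOn (slice b L)
    · intro σ hσ
      simp only [Finset.coe_filter, Set.mem_ofPred_eq, List.mem_toFinset, joinSet,
        List.mem_filter, decide_eq_true_eq] at hσ
      obtain ⟨⟨-, τ, hτ, h⟩, rfl⟩ := hσ
      simp only [Finset.coe_filter, Set.mem_ofPred_eq, mem_strings, length_slice, true_and]
      refine ⟨τ, hτ, ?_⟩
      have hpre := take_prefix_take (pad (slice b L σ)) (hL _ τ hτ)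
      have hx := take_pad_eq (slice b L σ)
      rw [length_slice] at hx
      rwa [h, hx] at hpre
    · intro σ hσ ρ hρ h
      simp only [Finset.coe_filter, Set.mem_ofPred_eq, List.mem_toFinset] at hσ hρ
      exact eq_of_slice_eq hbc (length_of_mem_joinSet hσ.1) (length_of_mem_joinSet hρ.1) h
        (hσ.2.trans hρ.2.symm)
  refine (Finset.sum_le_sum hfib).trans_eq ?_
  rw [Finset.sum_const, card_strings, nsmul_eq_mul, two_mul, pow_add]
  push_cast
  ring

/-! ### Bounds on values and use of oracle functions -/

theorem pair_le_pair {a a' b b' : ℕ} (ha : a ≤ a') (hb : b ≤ b') :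
    Nat.pair a b ≤ Nat.pair a' b' :=
  (StrictMono.monotone (fun _ _ h => Nat.pair_lt_pair_left b h) ha).trans
    (StrictMono.monotone (fun _ _ h => Nat.pair_lt_pair_right a' h) hb)

/-- `h` is a monotone bound, uniform in the oracle, on the values and on the use of `F`. -/
structure Bounds (h : ℕ → ℕ) (F : (ℕ → Bool) → ℕ → ℕ) : Prop where
  mono : Monotone h
  le : ∀ O n, F O n ≤ h n
  congr : ∀ O O' n, (∀ i < h n, O i = O' i) → F O n = F O' n

/-- A bound for a function defined by primitive recursion from functions bounded by `f`, `g`. -/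
def precBound (f g : ℕ → ℕ) (a n : ℕ) : ℕ :=
  n.rec (f a) fun y IH => IH + g (Nat.pair a (Nat.pair y IH))

theorem precBound_mono {f g : ℕ → ℕ} (hf : Monotone f) (hg : Monotone g) {a a' n n' : ℕ}
    (ha : a ≤ a') (hn : n ≤ n') : precBound f g a n ≤ precBound f g a' n' := by
  have h₁ : Monotone (precBound f g a) :=
    monotone_nat_of_le_succ fun n => Nat.le_add_right _ _
  refine (h₁ hn).trans ?_
  clear hn
  induction n' with
  | zero => exact hf ha
  | succ n ih => exact add_le_add ih (hg (pair_le_pair ha (pair_le_pair le_rfl ih)))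

theorem primrec_precBound {f g : ℕ → ℕ} (hf : Primrec f) (hg : Primrec g) :
    Primrec₂ (precBound f g) :=
  Primrec.nat_rec (g := fun a (p : ℕ × ℕ) => p.2 + g (Nat.pair a (Nat.pair p.1 p.2))) hf <|
    Primrec.nat_add.comp (Primrec.snd.comp Primrec.snd) <| hg.comp <|
      Primrec₂.natPair.comp Primrec.fst <| Primrec₂.natPair.comp (Primrec.fst.comp Primrec.snd)
        (Primrec.snd.comp Primrec.snd)

theorem Bounds.prec {hf hg : ℕ → ℕ} {f g : (ℕ → Bool) → ℕ → ℕ} (bf : Bounds hf f)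
    (bg : Bounds hg g) :
    Bounds (fun p => precBound hf hg p p) fun O p =>
      p.unpair.2.rec (f O p.unpair.1) fun y IH => g O (Nat.pair p.unpair.1 (Nat.pair y IH)) := by
  have hle : ∀ O a n, (n.rec (f O a) fun y IH => g O (Nat.pair a (Nat.pair y IH)) : ℕ)
      ≤ precBound hf hg a n := by
    intro O a n
    induction n with
    | zero => exact bf.le O a
    | succ n ih =>
      exact (bg.le _ _).trans ((bg.mono (pair_le_pair le_rfl (pair_le_pair le_rfl ih))).trans
        (Nat.le_add_left _ _))
  have hcongr : ∀ O O' a n, (∀ i < precBound hf hg a n, O i = O' i) →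
      (n.rec (f O a) fun y IH => g O (Nat.pair a (Nat.pair y IH)) : ℕ)
        = n.rec (f O' a) fun y IH => g O' (Nat.pair a (Nat.pair y IH)) := by
    intro O O' a n
    induction n with
    | zero => exact bf.congr O O' a
    | succ n ih =>
      intro h
      have ih' := ih fun i hi => h i (hi.trans_le (Nat.le_add_right _ _))
      dsimp only
      rw [← ih']
      refine bg.congr _ _ _ fun i hi => h i (hi.trans_le ?_)
      exact (bg.mono (pair_le_pair le_rfl (pair_le_pair le_rfl (hle O a n)))).trans
        (Nat.le_add_left _ _)
  have hp : ∀ p, precBound hf hg p.unpair.1 p.unpair.2 ≤ precBound hf hg p p := fun p =>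
    precBound_mono bf.mono bg.mono (Nat.unpair_left_le p) (Nat.unpair_right_le p)
  exact ⟨fun _ _ h => precBound_mono bf.mono bg.mono h h, fun O p => (hle O _ _).trans (hp p),
    fun O O' p h => hcongr O O' _ _ fun i hi => h i (hi.trans_le (hp p))⟩

/-- Every primitive recursive oracle function has a primitive recursive bound on its values and
its use. -/
theorem PrimrecIn.exists_bounds {F : (ℕ → Bool) → ℕ → ℕ} (hF : PrimrecIn F) :
    ∃ h : ℕ → ℕ, Primrec h ∧ Bounds h F := by
  induction hF with
  | zero => exact ⟨id, Primrec.id, monotone_id, fun _ _ => Nat.zero_le _, fun _ _ _ _ => rfl⟩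
  | succ =>
    exact ⟨Nat.succ, Primrec.succ, fun _ _ => Nat.succ_le_succ, fun _ _ => le_rfl,
      fun _ _ _ _ => rfl⟩
  | left =>
    exact ⟨id, Primrec.id, monotone_id, fun _ => Nat.unpair_left_le, fun _ _ _ _ => rfl⟩
  | right =>
    exact ⟨id, Primrec.id, monotone_id, fun _ => Nat.unpair_right_le, fun _ _ _ _ => rfl⟩
  | oracle =>
    refine ⟨Nat.succ, Primrec.succ, fun _ _ => Nat.succ_le_succ, fun O n => ?_,
      fun O O' n h => by rw [h n (Nat.lt_succ_self n)]⟩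
    cases O n <;> simp
  | pair _ _ ihf ihg =>
    obtain ⟨hf, pf, bf⟩ := ihf
    obtain ⟨hg, pg, bg⟩ := ihg
    refine ⟨fun n => Nat.pair (hf n) (hg n), Primrec₂.natPair.comp pf pg,
      fun _ _ h => pair_le_pair (bf.mono h) (bg.mono h),
      fun O n => pair_le_pair (bf.le O n) (bg.le O n), fun O O' n h => ?_⟩
    rw [bf.congr O O' n fun i hi => h i (hi.trans_le (Nat.left_le_pair _ _)),
      bg.congr O O' n fun i hi => h i (hi.trans_le (Nat.right_le_pair _ _))]
  | @comp f g _ _ ihf ihg =>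
    obtain ⟨hf, pf, bf⟩ := ihf
    obtain ⟨hg, pg, bg⟩ := ihg
    refine ⟨fun n => hg n + hf (hg n), Primrec.nat_add.comp pg (pf.comp pg),
      fun _ _ h => add_le_add (bg.mono h) (bf.mono (bg.mono h)),
      fun O n => (bf.le _ _).trans ((bf.mono (bg.le _ _)).trans (Nat.le_add_left _ _)),
      fun O O' n h => ?_⟩
    rw [← bg.congr O O' n fun i hi => h i (hi.trans_le (Nat.le_add_right _ _))]
    exact bf.congr _ _ _ fun i hi => h i
      (hi.trans_le ((bf.mono (bg.le _ _)).trans (Nat.le_add_left _ _)))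
  | prec _ _ ihf ihg =>
    obtain ⟨hf, pf, bf⟩ := ihf
    obtain ⟨hg, pg, bg⟩ := ihg
    exact ⟨_, (primrec_precBound pf pg).comp Primrec.id Primrec.id, bf.prec bg⟩

theorem primrec_pad : Primrec₂ pad := Primrec.list_getD false

/-- A primitive recursive oracle function is primitive recursive in a finite oracle. -/
theorem PrimrecIn.primrec_pad {F : (ℕ → Bool) → ℕ → ℕ} (hF : PrimrecIn F) :
    Primrec₂ fun (x : List Bool) n => F (pad x) n := by
  induction hF with
  | zero => exact Primrec₂.const 0
  | succ => exact Primrec.succ.comp Primrec.snd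
  | left => exact Primrec.fst.comp (Primrec.unpair.comp Primrec.snd)
  | right => exact Primrec.snd.comp (Primrec.unpair.comp Primrec.snd)
  | oracle =>
    exact Primrec.cond BP.primrec_pad (Primrec.const 1) (Primrec.const 0)
  | pair _ _ ihf ihg => exact Primrec₂.natPair.comp ihf ihg
  | comp _ _ ihf ihg => exact ihf.comp Primrec.fst ihg
  | @prec f g _ _ ihf ihg =>
    have hrec := Primrec.nat_rec (f := fun q : List Bool × ℕ => f (pad q.1) q.2)
      (g := fun q (p : ℕ × ℕ) => g (pad q.1) (Nat.pair q.2 (Nat.pair p.1 p.2))) ihf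
      (ihg.comp (Primrec.fst.comp Primrec.fst) <|
        Primrec₂.natPair.comp (Primrec.snd.comp Primrec.fst) <|
          Primrec₂.natPair.comp (Primrec.fst.comp Primrec.snd) (Primrec.snd.comp Primrec.snd))
    have hu : Primrec fun q : List Bool × ℕ => q.2.unpair := Primrec.unpair.comp Primrec.snd
    exact hrec.comp (Primrec.fst.pair (Primrec.fst.comp hu)) (Primrec.snd.comp hu)

theorem primrec_take {α : Type} [Primcodable α] {X : α → ℕ → Bool} {n : α → ℕ}
    (hX : Primrec₂ X) (hn : Primrec n) : Primrec fun a => take (X a) (n a) :=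
  Primrec.list_map (Primrec.list_range.comp hn) hX

theorem primrec_slice (b : ℕ) : Primrec₂ (slice b) :=
  primrec_take (X := fun q : ℕ × List Bool => fun i => pad q.2 (2 * i + b))
    (primrec_pad.comp (Primrec.snd.comp Primrec.fst) <| Primrec.nat_add.comp
      (Primrec.nat_mul.comp (Primrec.const 2) Primrec.snd) (Primrec.const b)) Primrec.fst

theorem primrec_two_pow : Primrec fun n : ℕ => 2 ^ n :=
  (Primrec₂.unpaired'.1 Nat.Primrec.pow).comp (Primrec.const 2) Primrec.id

theorem primrec_allStrings : Primrec allStrings := by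
  have hbit : Primrec₂ Nat.testBit := by
    refine Primrec.of_eq (f := fun q : ℕ × ℕ => decide (q.1 / 2 ^ q.2 % 2 = 1)) ?_
      fun q => Nat.testBit_eq_decide_div_mod_eq.symm
    exact (Primrec.eq.comp (Primrec.nat_mod.comp (Primrec.nat_div.comp Primrec.fst
      (primrec_two_pow.comp Primrec.snd)) (Primrec.const 2)) (Primrec.const 1)).decide
  exact Primrec.list_map (Primrec.list_range.comp primrec_two_pow) <|
    Primrec.list_map (Primrec.list_range.comp Primrec.fst) <|
      hbit.comp (Primrec.snd.comp Primrec.fst) Primrec.snd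

theorem primrec_joinSet (b c : ℕ) {L : ℕ → ℕ} {G : ℕ → List Bool → List (List Bool)}
    (hL : Primrec L) (hG : Primrec₂ G) : Primrec fun n => joinSet b c (L n) (G n) := by
  have hmatch : PrimrecRel fun (τ x : List Bool) => take (pad x) τ.length = τ :=
    Primrec.eq.comp (primrec_take (X := fun q : List Bool × List Bool => pad q.2)
      (primrec_pad.comp (Primrec.snd.comp Primrec.fst) Primrec.snd)
      (Primrec.list_length.comp Primrec.fst)) Primrec.fst
  have hslice : ∀ d, Primrec fun q : List Bool × ℕ => slice d (L q.2) q.1 := fun d =>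
    (primrec_slice d).comp (hL.comp Primrec.snd) Primrec.fst
  have hR : PrimrecRel fun (σ : List Bool) (n : ℕ) =>
      ∃ τ ∈ G n (slice c (L n) σ), take (pad (slice b (L n) σ)) τ.length = τ :=
    hmatch.exists_mem_list.comp (hG.comp Primrec.snd (hslice c)) (hslice b)
  exact hR.listFilter.comp
    (primrec_allStrings.comp (Primrec.nat_mul.comp (Primrec.const 2) hL)) Primrec.id

/-- If `Y` occupies the positions `≡ c` and `X` the positions `≡ b` of a random real, then `X` is
random relative to `Y`. -/
theorem MLBPRandom.rel {b c : ℕ} (hbc : b + c = 1) {X Y W : ℕ → Bool} (h : MLBPRandom W)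
    (hX : ∀ i, W (2 * i + b) = X i) (hY : ∀ i, W (2 * i + c) = Y i) : MLBPRandomRel X Y := by
  rintro G f ⟨⟨F, hF, hFG⟩, hf, hlen, hmu⟩
  obtain ⟨u, hu, bu⟩ := hF.exists_bounds
  have hcode : ∀ O n, F O n = Encodable.encode (G O n) + 1 := fun O n => by simp [hFG]
  have huse : ∀ O O' n, (∀ i < u n, O i = O' i) → G O n = G O' n := fun O O' n hO => by
    have := bu.congr O O' n hO
    rw [hcode, hcode] at this
    exact Encodable.encode_injective (Nat.succ_injective this)
  have hG : Primrec₂ fun (n : ℕ) (x : List Bool) => G (pad x) n := by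
    have hd : Primrec fun q : ℕ × List Bool =>
        (Encodable.decode (α := List (List Bool)) (F (pad q.2) q.1).pred).getD [] :=
      Primrec.option_getD.comp (Primrec.decode.comp (Primrec.pred.comp
        (hF.primrec_pad.comp Primrec.snd Primrec.fst))) (Primrec.const [])
    exact hd.of_eq fun q => by simp [hcode]
  have htest : IsTest fun n => joinSet b c (f n + u n) fun x => G (pad x) n :=
    ⟨primrec_joinSet b c (Primrec.nat_add.comp hf hu) hG, fun n => mu_joinSet_le hbc
      (fun z τ hτ => (hlen _ n τ hτ).trans (Nat.le_add_right _ _)) fun z => hmu _ n⟩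
  obtain ⟨n, hn⟩ := h _ htest
  refine ⟨n, fun ⟨τ, hτ, hXτ⟩ => hn ?_⟩
  set L := f n + u n with hL
  have hslice : ∀ {d : ℕ} {V : ℕ → Bool}, d ≤ 1 → (∀ i, W (2 * i + d) = V i) →
      slice d L (take W (2 * L)) = take V L := fun hd hV =>
    take_congr fun i hi => by rw [pad_take _ (by omega), hV]
  refine ⟨take W (2 * L), List.mem_filter.2 ⟨mem_allStrings.2 (length_take _ _), ?_⟩, ?_⟩
  · rw [decide_eq_true_eq, hslice (by omega) hX, hslice (by omega) hY]
    refine ⟨τ, ?_, ?_⟩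
    · have hG' : G (pad (take Y L)) n = G Y n := huse _ _ n fun i hi => pad_take Y (by omega)
      rw [← hG'] at hτ
      exact hτ
    · refine Eq.trans (take_congr fun i hi => pad_take _ ?_) hXτ
      have := hlen Y n τ hτ
      omega
  · rw [length_take]

theorem stmt15 (A B : ℕ → Bool) (h : MLBPRandom (join A B)) :
    MLBPRandomRel A B ∧ MLBPRandomRel B A := by
  have hA : ∀ i, join A B (2 * i + 0) = A i := fun i => by simp [join]
  have hB : ∀ i, join A B (2 * i + 1) = B i := fun i => by
    simp [join, Nat.add_mod, show (2 * i + 1) / 2 = i by omega]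
  exact ⟨h.rel (zero_add 1) hA hB, h.rel (add_zero 1) hB hA⟩

end BP
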